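/- Let d ≥ 4 be an integer. If q ∈ ℂ satisfies q ≠ 0, (q+1)^d = 1 + dq, and 2(1+q)^d = d(d−1)q² + dq + 2 + d(1+q)^(d−1)·q, then no such q exists; i.e., the system of these equations has no nonzero complex solution. -/

import Mathlib

/-- For `d ≥ 4`, there is no nonzero `q ∈ ℂ` with `(q+1)^d = 1 + dq` and
`2(1+q)^d = d(d−1)q² + dq + 2 + d(1+q)^(d−1)q`. -/
theorem stmt4 (d : ℕ) (hd : 4 ≤ d) (q : ℂ) (hq : q ≠ 0)
    (h1 : (q + 1)^d = 1 + (d : ℂ) * q)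
    (h2 : 2*(1+q)^d = (d : ℂ)*((d : ℂ)-1)*q^2 + (d : ℂ)*q + 2 + (d : ℂ)*(1+q)^(d-1)*q) :
    False := by
  obtain ⟨n, rfl⟩ : ∃ n, d = n + 1 := ⟨d - 1, by omega⟩
  have hn : (n : ℂ) ≠ 0 := by
    have : n ≠ 0 := by omega
    exact_mod_cast this
  have hn1 : (n : ℂ) + 1 ≠ 0 := by exact_mod_cast Nat.succ_ne_zero n
  have h1' := h1
  rw [add_comm q 1] at h1
  rw [h1] at h2
  rw [pow_succ] at h1
  simp only [Nat.add_sub_cancel] at h2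
  push_cast at h1 h2
  have hP : (1 + q)^n = 1 - n * q := by
    apply mul_left_cancel₀ (mul_ne_zero hn1 hq)
    linear_combination -h2
  rw [hP] at h1
  have hq2 : q = -2 := by
    apply mul_left_cancel₀ (mul_ne_zero hn hq)
    linear_combination -h1
  subst hq2
  have e : (-2 + 1 : ℂ) = -1 := by norm_num
  rw [e] at h1'
  rcases neg_one_pow_eq_or ℂ (n + 1) with h | h
  · rw [h] at h1'
    push_cast at h1'
    apply hn1
    linear_combination (1/2) * h1'
  · rw [h] at h1'
    push_cast at h1'
    apply hn
    linear_combination (1/2) * h1'
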